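/- For each i = 1,…,d, the kernel of the ℚ̄-algebra homomorphism ℚ̄[G] → End_ℚ̄(V_i ⊗_ℤ ℚ̄) given by the G-module structure of V_i ⊗_ℤ ℚ̄ is, as a ℚ̄[G]-module for the left regular action, isomorphic to ⊕_π π^{dim π}, the direct sum running over those irreducible ℚ̄-representations π of G such that either π is trivial or π has no nonzero vector fixed by τ_i = h_i^{-1} τ h_i. -/

import Mathlib

open NumberField TensorProduct

set_option maxHeartbeats 1000000

/-- The action of a `ℚ`-automorphism of a number field `H` on the units of its
ring of integers. -/
noncomputable def galU (H : Type*) [Field H] [NumberField H] (g : H ≃ₐ[ℚ] H) :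
    (𝓞 H)ˣ ≃* (𝓞 H)ˣ :=
  Units.mapEquiv (galRestrict ℤ ℚ H (𝓞 H) g).toRingEquiv.toMulEquiv

/-- The subgroup `V_i = { ∏_{g ∈ S} (h_i⁻¹(g(η)))^(a_g) : ∑ a_g = 0 }` of `𝓞_H^×`,
here given as a set, with `hi` playing the role of `h_i`. -/
noncomputable def VSet (H : Type*) [Field H] [NumberField H]
    (S : Finset (H ≃ₐ[ℚ] H)) (η : (𝓞 H)ˣ) (hi : H ≃ₐ[ℚ] H) : Set ((𝓞 H)ˣ) :=
  { u | ∃ a : (H ≃ₐ[ℚ] H) → ℤ,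
      (∑ g ∈ S, a g) = 0 ∧ u = ∏ g ∈ S, galU H (hi⁻¹ * g) η ^ a g }

/-- A fixed algebraic closure of `ℚ`. -/
abbrev Qbar : Type := AlgebraicClosure ℚ

/-- `𝓞_H^× ⊗_ℤ ℚ̄` as a `ℚ̄`-vector space. -/
noncomputable abbrev UnitsMod (H : Type*) [Field H] [NumberField H] : Type _ :=
  Qbar ⊗[ℤ] Additive ((𝓞 H)ˣ)

/-- The `ℚ̄`-linear action of `g ∈ Gal(H/ℚ)` on `𝓞_H^× ⊗_ℤ ℚ̄` induced by the Galois
action on units. -/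
noncomputable def actA (H : Type*) [Field H] [NumberField H] (g : H ≃ₐ[ℚ] H) :
    UnitsMod H →ₗ[Qbar] UnitsMod H :=
  LinearMap.baseChange Qbar
    (AddMonoidHom.toIntLinearMap (AddEquiv.toAddMonoidHom (MulEquiv.toAdditive (galU H g))))

/-- `V_i ⊗_ℤ ℚ̄`, realized as the `ℚ̄`-span of the image of `V_i` in `𝓞_H^× ⊗_ℤ ℚ̄`. -/
noncomputable def VMod (H : Type*) [Field H] [NumberField H]
    (S : Finset (H ≃ₐ[ℚ] H)) (η : (𝓞 H)ˣ) (hi : H ≃ₐ[ℚ] H) :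
    Submodule Qbar (UnitsMod H) :=
  Submodule.span Qbar
    ((fun u : (𝓞 H)ˣ => ((1 : Qbar) ⊗ₜ[ℤ] Additive.ofMul u : UnitsMod H)) '' VSet H S η hi)

/-- The space of `k`-linear maps `f : V → W` intertwining two actions `ρ`, `σg` of an
index type `G` and with image contained in a submodule `N`; for group actions this is
the space `Hom_{k[G]}(V, N)`. -/
def intertwiners (k : Type*) [Field k] {G : Type*} (V W : Type*)
    [AddCommGroup V] [Module k V] [AddCommGroup W] [Module k W]
    (ρ : G → V →ₗ[k] V) (σg : G → W →ₗ[k] W) (N : Submodule k W) :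
    Submodule k (V →ₗ[k] W) where
  carrier := {f | (∀ g : G, f ∘ₗ ρ g = σg g ∘ₗ f) ∧ ∀ v : V, f v ∈ N}
  add_mem' := by
    rintro a b ⟨ha1, ha2⟩ ⟨hb1, hb2⟩
    refine ⟨fun g => ?_, fun v => N.add_mem (ha2 v) (hb2 v)⟩
    rw [LinearMap.add_comp, LinearMap.comp_add, ha1 g, hb1 g]
  zero_mem' := by
    refine ⟨fun g => ?_, fun v => N.zero_mem⟩
    rw [LinearMap.zero_comp, LinearMap.comp_zero]
  smul_mem' := by
    rintro c a ⟨ha1, ha2⟩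
    refine ⟨fun g => ?_, fun v => N.smul_mem c (ha2 v)⟩
    rw [LinearMap.smul_comp, LinearMap.comp_smul, ha1 g]

section FrobeniusPart

variable {K G V : Type*} [Field K] [Group G] [Finite G]
  [AddCommGroup V] [Module K V]

/-- The augmentation of the group algebra. -/
noncomputable def augm (K G : Type*) [Field K] [Group G] : MonoidAlgebra K G →ₐ[K] K :=
  MonoidAlgebra.lift K K G (1 : G →* K)

lemma augm_single (g : G) (c : K) : augm K G (MonoidAlgebra.single g c) = c := by
  simp [augm, MonoidAlgebra.lift_single]

/-- The map `V^* → Hom(V, K[G])` of Frobenius reciprocity. -/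
noncomputable def frob (ρ : Representation K G V) :
    Module.Dual K V →ₗ[K] (V →ₗ[K] MonoidAlgebra K G) :=
  letI := Fintype.ofFinite G
  { toFun := fun φ =>
      { toFun := fun v => ∑ g : G, MonoidAlgebra.single g (φ (ρ g⁻¹ v))
        map_add' := by
          intro v w
          simp [Finset.sum_add_distrib, MonoidAlgebra.single_add]
        map_smul' := by
          intro c v
          simp [Finset.smul_sum] }
    map_add' := by
      intro φ ψ
      refine LinearMap.ext fun v => ?_
      simp [Finset.sum_add_distrib, MonoidAlgebra.single_add]
    map_smul' := by
      intro c φ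
      refine LinearMap.ext fun v => ?_
      simp [Finset.smul_sum] }

lemma coeff_frob (ρ : Representation K G V) (φ : Module.Dual K V) (v : V) (g : G) :
    (frob ρ φ v).coeff g = φ (ρ g⁻¹ v) := by
  classical
  letI := Fintype.ofFinite G
  change (∑ g : G, MonoidAlgebra.single g (φ (ρ g⁻¹ v))).coeff g = _
  rw [MonoidAlgebra.coeff_sum, Finsupp.finsetSum_apply]
  simp [MonoidAlgebra.coeff_single, Finsupp.single_apply]

lemma frob_mul (ρ : Representation K G V) (φ : Module.Dual K V) (v : V)
    (z : MonoidAlgebra K G) :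
    frob ρ φ v * z = frob ρ (φ ∘ₗ (MonoidAlgebra.lift K (Module.End K V) G ρ z)) v := by
  induction z using MonoidAlgebra.induction_linear with
  | zero => simp [LinearMap.comp_zero]
  | add f g hf hg => rw [mul_add, hf, hg, map_add, LinearMap.comp_add, map_add]; rfl
  | single h c =>
    apply MonoidAlgebra.ext
    ext g
    rw [coeff_frob, MonoidAlgebra.coeff_mul_single_apply, coeff_frob, MonoidAlgebra.lift_single]
    simp [mul_comm]

lemma frob_equivariant (ρ : Representation K G V) (φ : Module.Dual K V) (v : V) (h : G) :
    frob ρ φ (ρ h v) = MonoidAlgebra.single h 1 * frob ρ φ v := by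
  apply MonoidAlgebra.ext
  ext g
  rw [coeff_frob, MonoidAlgebra.coeff_single_mul_apply, coeff_frob]
  simp

lemma frob_injective (ρ : Representation K G V) : Function.Injective (frob ρ) := by
  intro φ ψ hh
  ext v
  have := congrArg (fun f => (f v).coeff 1) hh
  simpa [coeff_frob] using this

lemma exists_frob (ρ : Representation K G V) (f : V →ₗ[K] MonoidAlgebra K G)
    (hf : ∀ g : G, f ∘ₗ ρ g = LinearMap.mulLeft K (MonoidAlgebra.single g 1) ∘ₗ f) :
    ∃ φ, f = frob ρ φ := by
  let φ : Module.Dual K V :=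
    { toFun := fun v => (f v).coeff 1
      map_add' := by intros; simp
      map_smul' := by intros; simp }
  refine ⟨φ, LinearMap.ext fun v => ?_⟩
  apply MonoidAlgebra.ext
  ext g
  rw [coeff_frob]
  change _ = (f (ρ g⁻¹ v)).coeff 1
  have := LinearMap.congr_fun (hf g⁻¹) v
  simp only [LinearMap.comp_apply, LinearMap.mulLeft_apply] at this
  rw [this, MonoidAlgebra.coeff_single_mul_apply]
  simp

theorem rep_main [CharZero K] [FiniteDimensional K V] [Nontrivial V]
    (ρ : Representation K G V) (t : G) (ht : t * t = 1)
    (hirr : ∀ W : Submodule K V, (∀ g : G, ∀ v ∈ W, ρ g v ∈ W) → W = ⊥ ∨ W = ⊤)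
    (J : Submodule K (MonoidAlgebra K G))
    (hJ : ∀ x, x ∈ J ↔ ∀ y, augm K G y = 0 →
      x * y * (1 + MonoidAlgebra.single t 1) = 0) :
    (((∀ g : G, ρ g = LinearMap.id) ∨ LinearMap.ker (ρ t - LinearMap.id) = ⊥) →
      Module.finrank K
        ↥(intertwiners K V (MonoidAlgebra K G) (fun g : G => ρ g)
            (fun g : G => LinearMap.mulLeft K (MonoidAlgebra.single g 1)) J)
          = Module.finrank K V) ∧
    ((¬ ((∀ g : G, ρ g = LinearMap.id) ∨ LinearMap.ker (ρ t - LinearMap.id) = ⊥)) →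
      Module.finrank K
        ↥(intertwiners K V (MonoidAlgebra K G) (fun g : G => ρ g)
            (fun g : G => LinearMap.mulLeft K (MonoidAlgebra.single g 1)) J) = 0) := by
  set L := MonoidAlgebra.lift K (Module.End K V) G ρ with hL
  have hLs : ∀ g, L (MonoidAlgebra.single g 1) = ρ g := by
    intro g; rw [hL, MonoidAlgebra.lift_single, one_smul]
  have hLt : L (1 + MonoidAlgebra.single t 1) = 1 + ρ t := by
    rw [map_add, map_one, hLs]
  have hmem : ∀ φ : Module.Dual K V, (∀ v, frob ρ φ v ∈ J) ↔
      ∀ y, augm K G y = 0 → φ ∘ₗ (L y * (1 + ρ t)) = 0 := by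
    intro φ
    constructor
    · intro h y hy
      apply frob_injective ρ
      refine LinearMap.ext fun v => ?_
      have := (hJ _).1 (h v) y hy
      rw [mul_assoc, frob_mul, ← hL, map_mul, hLt] at this
      simpa using this
    · intro h v
      rw [hJ]
      intro y hy
      rw [mul_assoc, frob_mul, ← hL, map_mul, hLt, h y hy]
      simp
  have htt : ρ t * ρ t = 1 := by rw [← map_mul, ht, map_one]
  constructor
  · intro hc
    have hall : ∀ y, augm K G y = 0 → L y * (1 + ρ t) = 0 := by
      intro y hy
      rcases hc with hc | hc
      · have : ∀ z, L z = augm K G z • (1 : Module.End K V) := by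
          intro z
          induction z using MonoidAlgebra.induction_linear with
          | zero => simp
          | add f g hf hg => rw [map_add, map_add, hf, hg, add_smul]
          | single h c =>
            rw [augm_single, hL, MonoidAlgebra.lift_single, hc]; rfl
        rw [this, hy]; simp
      · have : (1 + ρ t : Module.End K V) = 0 := by
          refine LinearMap.ext fun v => ?_
          have h2 : (1 + ρ t : Module.End K V) v ∈ LinearMap.ker (ρ t - LinearMap.id) := by
            rw [LinearMap.mem_ker]
            have h3 := LinearMap.congr_fun htt v
            simp only [Module.End.mul_apply, Module.End.one_apply] at h3
            simp only [LinearMap.add_apply, LinearMap.sub_apply, LinearMap.id_apply,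
              Module.End.one_apply, map_add, h3]
            abel
          rw [hc] at h2
          simpa using h2
        rw [this, mul_zero]
    have : intertwiners K V (MonoidAlgebra K G) (fun g : G => ρ g)
            (fun g : G => LinearMap.mulLeft K (MonoidAlgebra.single g 1)) J
            = LinearMap.range (frob ρ) := by
      apply le_antisymm
      · rintro f ⟨hf, -⟩
        obtain ⟨φ, rfl⟩ := exists_frob ρ f hf
        exact ⟨φ, rfl⟩
      · rintro _ ⟨φ, rfl⟩
        refine ⟨fun g => LinearMap.ext fun v => frob_equivariant ρ φ v g, ?_⟩
        rw [hmem]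
        intro y hy
        rw [hall y hy, LinearMap.comp_zero]
    rw [this, LinearMap.finrank_range_of_inj (frob_injective ρ), Subspace.dual_finrank_eq]
  · intro hc
    push Not at hc
    obtain ⟨⟨g0, hg0⟩, hk⟩ := hc
    obtain ⟨v0, hv0, hv0'⟩ := (Submodule.ne_bot_iff _).1 hk
    have hfix : ρ t v0 = v0 := by
      rw [LinearMap.mem_ker] at hv0
      simpa [sub_eq_zero] using hv0
    have hbot : intertwiners K V (MonoidAlgebra K G) (fun g : G => ρ g)
            (fun g : G => LinearMap.mulLeft K (MonoidAlgebra.single g 1)) J = ⊥ := by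
      rw [eq_bot_iff]
      rintro f ⟨hf, hfJ⟩
      obtain ⟨φ, rfl⟩ := exists_frob ρ f hf
      rw [hmem] at hfJ
      have hφ : ∀ y, augm K G y = 0 → φ (L y v0) = 0 := by
        intro y hy
        have := LinearMap.congr_fun (hfJ y hy) v0
        have h2 : (1 + ρ t : Module.End K V) v0 = (2 : K) • v0 := by
          rw [LinearMap.add_apply, hfix, two_smul]; rfl
        rw [LinearMap.comp_apply, Module.End.mul_apply, h2, map_smul, map_smul] at this
        simpa using this
      let W : Submodule K V :=
        { carrier := {v | ∃ y, augm K G y = 0 ∧ L y v0 = v}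
          zero_mem' := ⟨0, by simp, by simp⟩
          add_mem' := by
            rintro _ _ ⟨y, hy, rfl⟩ ⟨z, hz, rfl⟩
            exact ⟨y + z, by rw [map_add, hy, hz, add_zero], by rw [map_add]; rfl⟩
          smul_mem' := by
            rintro c _ ⟨y, hy, rfl⟩
            exact ⟨c • y, by rw [map_smul, hy, smul_zero], by rw [map_smul]; rfl⟩ }
      have hW : W = ⊥ ∨ W = ⊤ := by
        apply hirr
        rintro g _ ⟨y, hy, rfl⟩
        exact ⟨MonoidAlgebra.single g 1 * y, by rw [map_mul, hy, mul_zero],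
          by rw [map_mul, hLs]; rfl⟩
      rcases hW with hW | hW
      · exfalso
        have hinv : ∀ g, ρ g v0 = v0 := by
          intro g
          have : ρ g v0 - v0 ∈ W :=
            ⟨MonoidAlgebra.single g 1 - 1, by rw [map_sub, augm_single, map_one, sub_self],
              by rw [map_sub, hLs, map_one]; rfl⟩
          rw [hW, Submodule.mem_bot, sub_eq_zero] at this
          exact this
        let W' : Submodule K V :=
          { carrier := {v | ∀ g, ρ g v = v}
            zero_mem' := by intro g; simp
            add_mem' := by intro a b ha hb g; rw [map_add, ha g, hb g]
            smul_mem' := by intro c a ha g; rw [map_smul, ha g] }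
        rcases hirr W' (by intro g v hv; rw [hv g]; exact hv) with h | h
        · apply hv0'
          have : v0 ∈ W' := hinv
          rwa [h, Submodule.mem_bot] at this
        · apply hg0
          refine LinearMap.ext fun v => ?_
          have : v ∈ W' := by rw [h]; trivial
          exact this g0
      · have : φ = 0 := by
          refine LinearMap.ext fun v => ?_
          have : v ∈ W := by rw [hW]; trivial
          obtain ⟨y, hy, rfl⟩ := this
          exact hφ y hy
        rw [this, map_zero]
        exact Submodule.zero_mem _
    rw [hbot, finrank_bot]

end FrobeniusPart

section UnitsPart

variable (H : Type*) [Field H] [NumberField H]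

lemma galU_mul (g h : H ≃ₐ[ℚ] H) (u : (𝓞 H)ˣ) : galU H (g * h) u = galU H g (galU H h u) := by
  apply Units.ext
  simp [galU]

lemma galU_one (u : (𝓞 H)ˣ) : galU H 1 u = u := by
  apply Units.ext
  simp [galU]

/-- The image of `g(η)` in `𝓞_H^× ⊗ ℚ̄`. -/
noncomputable def eU (η : (𝓞 H)ˣ) (g : H ≃ₐ[ℚ] H) : UnitsMod H :=
  (1 : Qbar) ⊗ₜ[ℤ] Additive.ofMul (galU H g η)

lemma actA_tmul (g : H ≃ₐ[ℚ] H) (c : Qbar) (u : (𝓞 H)ˣ) :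
    actA H g (c ⊗ₜ[ℤ] Additive.ofMul u) = c ⊗ₜ[ℤ] Additive.ofMul (galU H g u) := rfl

lemma actA_eU (η : (𝓞 H)ˣ) (g x : H ≃ₐ[ℚ] H) : actA H g (eU H η x) = eU H η (g * x) := by
  rw [eU, actA_tmul, eU, galU_mul]

/-- `actA` as a monoid homomorphism. -/
noncomputable def actHom : (H ≃ₐ[ℚ] H) →* Module.End Qbar (UnitsMod H) where
  toFun := actA H
  map_one' := by
    refine LinearMap.ext fun x => ?_
    induction x using TensorProduct.induction_on with
    | zero => simp
    | add x y hx hy => rw [map_add, hx, hy, map_add]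
    | tmul c u =>
      induction u using Additive.rec with
      | ofMul u => rw [actA_tmul, galU_one]; rfl
  map_mul' g h := by
    refine LinearMap.ext fun x => ?_
    induction x using TensorProduct.induction_on with
    | zero => simp
    | add x y hx hy => rw [map_add, hx, hy, map_add]
    | tmul c u =>
      induction u using Additive.rec with
      | ofMul u => rw [Module.End.mul_apply, actA_tmul, actA_tmul, actA_tmul, galU_mul]

lemma one_tmul_prod (η : (𝓞 H)ˣ) (S : Finset (H ≃ₐ[ℚ] H)) (k : H ≃ₐ[ℚ] H)
    (a : (H ≃ₐ[ℚ] H) → ℤ) :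
    ((1 : Qbar) ⊗ₜ[ℤ] Additive.ofMul (∏ g ∈ S, galU H (k * g) η ^ a g) : UnitsMod H)
      = ∑ g ∈ S, (a g : Qbar) • eU H η (k * g) := by
  rw [ofMul_prod, TensorProduct.tmul_sum]
  refine Finset.sum_congr rfl fun g _ => ?_
  rw [ofMul_zpow, eU, Int.cast_smul_eq_zsmul]
  exact TensorProduct.tmul_smul (a g) (1 : Qbar) (Additive.ofMul (galU H (k * g) η))

variable {H} {τ : H ≃ₐ[ℚ] H} {η : (𝓞 H)ˣ} {T : Finset (H ≃ₐ[ℚ] H)}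

lemma eU_mul_tau (hητ : galU H τ η = η) (g : H ≃ₐ[ℚ] H) : eU H η (g * τ) = eU H η g := by
  rw [eU, eU, galU_mul, hητ]

lemma const_on_T
    (hηT : (∏ g ∈ T, galU H g η) = 1)
    (hηker : ∀ a : (H ≃ₐ[ℚ] H) → ℤ,
      (∏ g ∈ T, galU H g η ^ a g) = 1 ↔ ∃ c : ℤ, ∀ g ∈ T, a g = c)
    (b : (H ≃ₐ[ℚ] H) → Qbar) (hb : ∑ t ∈ T, b t • eU H η t = 0)
    (t0 : H ≃ₐ[ℚ] H) (ht0 : t0 ∈ T) : ∀ t ∈ T, b t = b t0 := by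
  classical
  have hsum : ∑ t ∈ T, eU H η t = 0 := by
    have := one_tmul_prod H η T 1 1
    simp only [one_mul, Pi.one_apply, zpow_one, Int.cast_one, one_smul] at this
    rw [← this, hηT]
    simp
  have hli : LinearIndepOn ℤ (fun g => Additive.ofMul (galU H g η)) (↑(T.erase t0) : Set _) := by
    rw [linearIndepOn_finset_iff]
    intro a ha t ht
    have h2 : (∏ g ∈ T, galU H g η ^ (Function.update a t0 0) g) = 1 := by
      rw [← Finset.mul_prod_erase _ _ ht0]
      have : ∏ g ∈ T.erase t0, galU H g η ^ (Function.update a t0 0) g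
          = ∏ g ∈ T.erase t0, galU H g η ^ a g := by
        refine Finset.prod_congr rfl fun g hg => ?_
        rw [Function.update_of_ne (Finset.ne_of_mem_erase hg)]
      rw [this]
      apply Additive.ofMul.injective
      simpa [ofMul_prod, ofMul_zpow] using ha
    obtain ⟨c, hc⟩ := (hηker _).1 h2
    have h3 := hc t0 ht0
    have h4 := hc t (Finset.mem_of_mem_erase ht)
    rw [Function.update_self] at h3
    rw [Function.update_of_ne (Finset.ne_of_mem_erase ht), ← h3] at h4
    exact h4
  have hli2 : LinearIndepOn Qbar (eU H η) (↑(T.erase t0) : Set _) :=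
    Module.Flat.linearIndependent_one_tmul (R := ℤ) (S := Qbar) hli
  rw [linearIndepOn_finset_iff] at hli2
  have hz : ∑ t ∈ T.erase t0, (b t - b t0) • eU H η t = 0 := by
    have : ∑ t ∈ T, (b t - b t0) • eU H η t = 0 := by
      simp only [sub_smul, Finset.sum_sub_distrib, hb, ← Finset.smul_sum, hsum]
      simp
    rw [← Finset.add_sum_erase _ _ ht0] at this
    simpa using this
  intro t ht
  by_cases h : t = t0
  · rw [h]
  · exact sub_eq_zero.1 (hli2 _ hz t (Finset.mem_erase.2 ⟨h, ht⟩))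

lemma const_all [Fintype (H ≃ₐ[ℚ] H)] (hτ2 : τ * τ = 1) (hτ1 : τ ≠ 1)
    (hητ : galU H τ η = η)
    (hT : ∀ g : H ≃ₐ[ℚ] H, ∃! t, t ∈ T ∧ (t = g ∨ t = g * τ))
    (hηT : (∏ g ∈ T, galU H g η) = 1)
    (hηker : ∀ a : (H ≃ₐ[ℚ] H) → ℤ,
      (∏ g ∈ T, galU H g η ^ a g) = 1 ↔ ∃ c : ℤ, ∀ g ∈ T, a g = c)
    (c : (H ≃ₐ[ℚ] H) → Qbar) (hc : ∑ g, c g • eU H η g = 0) :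
    ∃ k, ∀ g, c g + c (g * τ) = k := by
  classical
  have hττ : ∀ g : H ≃ₐ[ℚ] H, g * τ * τ = g := fun g => by rw [mul_assoc, hτ2, mul_one]
  have huniv : (Finset.univ : Finset (H ≃ₐ[ℚ] H)) = T ∪ T.image (· * τ) := by
    ext g
    simp only [Finset.mem_univ, Finset.mem_union, Finset.mem_image, true_iff]
    obtain ⟨t, ⟨ht, h | h⟩, -⟩ := hT g
    · left; rwa [← h]
    · right; exact ⟨t, ht, by rw [h, hττ]⟩
  have hdisj : Disjoint T (T.image (· * τ)) := by
    rw [Finset.disjoint_left]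
    intro t ht ht'
    obtain ⟨t', ht2, rfl⟩ := Finset.mem_image.1 ht'
    have := (hT t').unique ⟨ht2, Or.inl rfl⟩ ⟨ht, Or.inr rfl⟩
    exact hτ1 (mul_left_cancel (this.symm.trans (mul_one t').symm))
  rw [huniv, Finset.sum_union hdisj, Finset.sum_image (fun a _ b _ h => mul_right_cancel h),
    ← Finset.sum_add_distrib] at hc
  have hc2 : ∑ t ∈ T, (c t + c (t * τ)) • eU H η t = 0 := by
    rw [← hc]
    refine Finset.sum_congr rfl fun t _ => ?_
    rw [eU_mul_tau hητ, add_smul]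
  obtain ⟨t0, ⟨ht0, -⟩, -⟩ := hT 1
  have hconst := const_on_T hηT hηker (fun t => c t + c (t * τ)) hc2 t0 ht0
  refine ⟨c t0 + c (t0 * τ), fun g => ?_⟩
  obtain ⟨t, ⟨ht, h | h⟩, -⟩ := hT g
  · rw [← h]; exact hconst t ht
  · have := hconst t ht
    simp only [h, hττ] at this
    rw [add_comm]; rw [this]

end UnitsPart

theorem kernel_aux (H : Type*) [Field H] [NumberField H] [IsGalois ℚ H]
    (τ : H ≃ₐ[ℚ] H) (hτ2 : τ * τ = 1) (hτ1 : τ ≠ 1)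
    (Gsub : Subgroup (H ≃ₐ[ℚ] H)) [hN : Gsub.Normal]
    (η : (𝓞 H)ˣ) (hητ : galU H τ η = η)
    (T : Finset (H ≃ₐ[ℚ] H))
    (hT : ∀ g : H ≃ₐ[ℚ] H, ∃! t, t ∈ T ∧ (t = g ∨ t = g * τ))
    (hηT : (∏ g ∈ T, galU H g η) = 1)
    (hηker : ∀ a : (H ≃ₐ[ℚ] H) → ℤ,
      (∏ g ∈ T, galU H g η ^ a g) = 1 ↔ ∃ c : ℤ, ∀ g ∈ T, a g = c)
    (S : Finset (H ≃ₐ[ℚ] H)) (hSG : ∀ s ∈ S, s ∈ Gsub)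
    (hS : ∀ g ∈ Gsub, ∃! s, s ∈ S ∧ (s = g ∨ s = g * τ))
    (σ : H ≃ₐ[ℚ] H) (hτi : σ⁻¹ * τ * σ ∈ Gsub)
    (Φ : MonoidAlgebra Qbar ↥Gsub →ₐ[Qbar] Module.End Qbar ↥(VMod H S η σ))
    (hΦ : ∀ (g : ↥Gsub) (w : ↥(VMod H S η σ)),
      (↑(Φ (MonoidAlgebra.single g 1) w) : UnitsMod H) = actA H ↑g ↑w) :
    (⟨σ⁻¹ * τ * σ, hτi⟩ : ↥Gsub) * ⟨σ⁻¹ * τ * σ, hτi⟩ = 1 ∧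
    ∀ x, x ∈ LinearMap.ker Φ.toLinearMap ↔ ∀ y, augm Qbar ↥Gsub y = 0 →
      x * y * (1 + MonoidAlgebra.single (⟨σ⁻¹ * τ * σ, hτi⟩ : ↥Gsub) 1) = 0 := by
  classical
  letI : Fintype (H ≃ₐ[ℚ] H) := Fintype.ofFinite _
  set t : ↥Gsub := ⟨σ⁻¹ * τ * σ, hτi⟩ with ht
  have htt : t * t = 1 := by
    apply Subtype.ext
    change σ⁻¹ * τ * σ * (σ⁻¹ * τ * σ) = 1
    have : σ⁻¹ * τ * σ * (σ⁻¹ * τ * σ) = σ⁻¹ * (τ * τ) * σ := by group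
    rw [this, hτ2]; group
  have htinv : t⁻¹ = t := inv_eq_of_mul_eq_one_left htt
  have htσ : ∀ g : ↥Gsub, (↑(g * t) : H ≃ₐ[ℚ] H) * σ⁻¹ = ↑g * σ⁻¹ * τ := by
    intro g
    change (↑g * (σ⁻¹ * τ * σ)) * σ⁻¹ = _
    group
  refine ⟨htt, ?_⟩
  set w : UnitsMod H := eU H η σ⁻¹ with hw
  set A : MonoidAlgebra Qbar ↥Gsub →ₐ[Qbar] Module.End Qbar (UnitsMod H) :=
    MonoidAlgebra.lift Qbar _ _ ((actHom H).comp Gsub.subtype) with hA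
  have hAs : ∀ g c, A (MonoidAlgebra.single g c) = c • actA H ↑g := by
    intro g c
    rw [hA, MonoidAlgebra.lift_single]; rfl
  have hAw : ∀ g c, A (MonoidAlgebra.single g c) w = c • eU H η (↑g * σ⁻¹) := by
    intro g c
    rw [hAs, LinearMap.smul_apply, hw, actA_eU]
  have hΦA : ∀ x v, (↑(Φ x v) : UnitsMod H) = A x ↑v := by
    intro x v
    induction x using MonoidAlgebra.induction_linear with
    | zero => simp
    | add f g hf hg => rw [map_add, map_add, LinearMap.add_apply, LinearMap.add_apply,
        Submodule.coe_add, hf, hg]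
    | single g c =>
      have : (MonoidAlgebra.single g c : MonoidAlgebra Qbar ↥Gsub)
          = c • MonoidAlgebra.single g 1 := by simp
      rw [this, map_smul, map_smul, LinearMap.smul_apply, LinearMap.smul_apply,
        Submodule.coe_smul, hΦ, hAs, one_smul]
  -- the kernel of `y ↦ y w` on the augmentation ideal
  have hker : ∀ y, augm Qbar ↥Gsub y = 0 → A y w = 0 →
      y * (1 + MonoidAlgebra.single t 1) = 0 := by
    intro y hy hyw
    set j : ↥Gsub → (H ≃ₐ[ℚ] H) := fun g => ↑g * σ⁻¹ with hj
    have hjinj : Function.Injective j := fun a b hab => Subtype.ext (mul_right_cancel hab)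
    set c := y.coeff.mapDomain j with hc
    have h1 : ∑ g, c g • eU H η g = 0 := by
      rw [← hyw, hA, MonoidAlgebra.lift_apply]
      rw [← Finsupp.sum_fintype c (fun g r => r • eU H η g) (fun g => zero_smul _ _), hc,
        Finsupp.sum_mapDomain_index (h := fun g r => r • eU H η g)
          (fun _ => zero_smul _ _) (fun _ _ _ => add_smul _ _ _)]
      rw [Finsupp.sum, Finsupp.sum, LinearMap.sum_apply]
      refine Finset.sum_congr rfl fun g _ => ?_
      rw [LinearMap.smul_apply]
      change _ = y.coeff g • actA H ↑g w
      rw [hw, actA_eU]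
    have h2 : ∑ g, c g = 0 := by
      rw [← hy, augm, MonoidAlgebra.lift_apply,
        ← Finsupp.sum_fintype c (fun g r => r) (fun g => rfl), hc,
        Finsupp.sum_mapDomain_index (h := fun _ r => r) (fun _ => rfl) (fun _ _ _ => rfl)]
      simp
    obtain ⟨k, hk⟩ := const_all hτ2 hτ1 hητ hT hηT hηker c h1
    have h3 : ∑ g, (c g + c (g * τ)) = 0 := by
      rw [Finset.sum_add_distrib, h2, zero_add]
      rw [← h2]
      exact Fintype.sum_equiv (Equiv.mulRight τ) _ _ (fun g => rfl)
    have hk0 : k = 0 := by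
      simp only [hk, Finset.sum_const, nsmul_eq_mul, mul_eq_zero] at h3
      rcases h3 with h3 | h3
      · exact absurd (Nat.cast_eq_zero.1 h3) Fintype.card_ne_zero
      · exact h3
    apply MonoidAlgebra.ext
    ext g
    have h4 := hk (j g)
    have h5 : j g * τ = j (g * t) := (htσ g).symm
    rw [h5, hc, Finsupp.mapDomain_apply hjinj, Finsupp.mapDomain_apply hjinj, hk0] at h4
    rw [mul_add, mul_one, MonoidAlgebra.coeff_add, Finsupp.add_apply,
      MonoidAlgebra.coeff_mul_single_apply, htinv, mul_one, h4]
    simp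
  have hker2 : ∀ y, y * (1 + MonoidAlgebra.single t 1) = 0 → A y w = 0 := by
    intro y hy
    have h1 : A (1 + MonoidAlgebra.single t 1) w = (2 : Qbar) • w := by
      have := htσ 1
      rw [one_mul] at this
      rw [map_add, map_one, LinearMap.add_apply, hAw, this, eU_mul_tau hητ, two_smul, one_smul]
      simp [hw]
    have h2 : A (y * (1 + MonoidAlgebra.single t 1)) w = 0 := by rw [hy]; simp
    rw [map_mul, Module.End.mul_apply, h1, map_smul] at h2
    simpa using h2
  -- description of `V_i`
  have hV1 : ∀ x ∈ VMod H S η σ, ∃ y, augm Qbar ↥Gsub y = 0 ∧ x = A y w := by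
    intro x hx
    induction hx using Submodule.span_induction with
    | mem x hx =>
      obtain ⟨u, ⟨a, ha, rfl⟩, rfl⟩ := hx
      have hconj : ∀ s ∈ S, σ⁻¹ * s * σ ∈ Gsub := by
        intro s hs
        have := hN.conj_mem s (hSG s hs) σ⁻¹
        rwa [inv_inv] at this
      refine ⟨∑ s ∈ S.attach,
        MonoidAlgebra.single ⟨σ⁻¹ * s * σ, hconj s s.2⟩ (a s : Qbar), ?_, ?_⟩
      · rw [map_sum]
        simp only [augm_single]
        rw [Finset.sum_attach S (fun s => (a s : Qbar)), ← Int.cast_sum, ha, Int.cast_zero]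
      · change (1 : Qbar) ⊗ₜ[ℤ] Additive.ofMul _ = _
        rw [one_tmul_prod, map_sum, LinearMap.sum_apply, ← Finset.sum_attach]
        refine Finset.sum_congr rfl fun s _ => ?_
        rw [hAw]
        congr 2
        change _ = σ⁻¹ * ↑s * σ * σ⁻¹
        group
    | zero => exact ⟨0, by simp, by simp⟩
    | add x y _ _ hx hy =>
      obtain ⟨p, hp, rfl⟩ := hx
      obtain ⟨q, hq, rfl⟩ := hy
      exact ⟨p + q, by rw [map_add, hp, hq, add_zero], by rw [map_add]; rfl⟩
    | smul c x _ hx =>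
      obtain ⟨p, hp, rfl⟩ := hx
      exact ⟨c • p, by rw [map_smul, hp, smul_zero], by rw [map_smul]; rfl⟩
  have hrep : ∀ g ∈ Gsub, ∃ s ∈ S, eU H η (σ⁻¹ * g) = eU H η (σ⁻¹ * s) := by
    intro g hg
    obtain ⟨s, ⟨hs, h' | h'⟩, -⟩ := hS g hg
    · exact ⟨s, hs, by rw [h']⟩
    · exact ⟨s, hs, by rw [h', ← mul_assoc, eU_mul_tau hητ]⟩
  have hV2 : ∀ y, A y w - augm Qbar ↥Gsub y • w ∈ VMod H S η σ := by
    intro y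
    induction y using MonoidAlgebra.induction_linear with
    | zero => simp
    | add f g hf hg =>
      have : A (f + g) w - augm Qbar ↥Gsub (f + g) • w
          = (A f w - augm Qbar ↥Gsub f • w) + (A g w - augm Qbar ↥Gsub g • w) := by
        rw [map_add, map_add, LinearMap.add_apply, add_smul]; abel
      rw [this]
      exact Submodule.add_mem _ hf hg
    | single g c =>
      rw [hAw, augm_single, ← smul_sub]
      apply Submodule.smul_mem
      have hgm : σ * (g : H ≃ₐ[ℚ] H) * σ⁻¹ ∈ Gsub := hN.conj_mem (g : H ≃ₐ[ℚ] H) g.2 σ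
      obtain ⟨s, hs, hse⟩ := hrep (σ * (g : H ≃ₐ[ℚ] H) * σ⁻¹) hgm
      obtain ⟨s0, hs0, hse0⟩ := hrep 1 Gsub.one_mem
      have e1 : σ⁻¹ * (σ * (g : H ≃ₐ[ℚ] H) * σ⁻¹) = (g : H ≃ₐ[ℚ] H) * σ⁻¹ := by group
      rw [e1] at hse
      rw [mul_one] at hse0
      rw [hse, hw, hse0]
      apply Submodule.subset_span
      refine ⟨_, ⟨Pi.single s 1 - Pi.single s0 1, ?_, rfl⟩, ?_⟩
      · simp [Finset.sum_sub_distrib, Pi.single_apply, hs, hs0]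
      · change (1 : Qbar) ⊗ₜ[ℤ] Additive.ofMul _ = _
        rw [one_tmul_prod]
        simp [sub_smul, Finset.sum_sub_distrib, Pi.single_apply, hs, hs0, ite_smul]
  intro x
  rw [LinearMap.mem_ker]
  constructor
  · intro hx y hy
    have hmem : A y w ∈ VMod H S η σ := by
      have := hV2 y
      rwa [hy, zero_smul, sub_zero] at this
    apply hker
    · rw [map_mul, hy, mul_zero]
    · rw [map_mul, Module.End.mul_apply, ← hΦA x ⟨_, hmem⟩]
      have hx' : Φ x = 0 := hx
      rw [hx']; rfl
  · intro hx
    change Φ x = 0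
    refine LinearMap.ext fun v => Subtype.ext ?_
    obtain ⟨y, hy, hyv⟩ := hV1 v v.2
    rw [hΦA, hyv, ← Module.End.mul_apply, ← map_mul, hker2 _ (hx y hy)]
    rfl

/-- The kernel of the `ℚ̄`-algebra homomorphism
`ℚ̄[G] → End_ℚ̄(V_i ⊗ ℚ̄)` given by the `G`-module structure of `V_i ⊗ ℚ̄` is, as a
`ℚ̄[G]`-module for the left regular action, isomorphic to `⊕_π π^{dim π}`, the sum over
the irreducible `π` which are trivial or have no nonzero `τᵢ`-fixed vector.  This is
expressed via multiplicities: for every irreducible `π = (V, ρ)`, the dimension of the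
space of `ℚ̄[G]`-equivariant maps from `V` into the kernel equals `dim V` if `π` is
trivial or has no nonzero `τᵢ`-fixed vector, and `0` otherwise. -/
theorem stmt_8 (H : Type*) [Field H] [NumberField H] [IsGalois ℚ H]
    (hH : (H →+* ℝ) → False)
    (ι : H →+* ℂ) (τ : H ≃ₐ[ℚ] H)
    (hιτ : ∀ x : H, ι (τ x) = starRingEnd ℂ (ι x))
    (hτ2 : τ * τ = 1) (hτ1 : τ ≠ 1)
    -- `G = Gal(H/F)` for a totally real subfield `F ⊆ H`, Galois over `ℚ`, of degree `d`
    (d : ℕ) (hd : 0 < d)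
    (Gsub : Subgroup (H ≃ₐ[ℚ] H)) [Gsub.Normal] (hGd : Gsub.index = d)
    (hτG : τ ∈ Gsub)
    -- representatives of the left cosets of `G` in `Gal(H/ℚ)`, with `h 0 = 1`
    (h : Fin d → (H ≃ₐ[ℚ] H)) (hreps : ∀ g : H ≃ₐ[ℚ] H, ∃! i : Fin d, (h i)⁻¹ * g ∈ Gsub)
    (h1 : h ⟨0, hd⟩ = 1)
    -- the Minkowski unit `η`
    (η : (𝓞 H)ˣ) (hητ : galU H τ η = η)
    (T : Finset (H ≃ₐ[ℚ] H))
    (hT : ∀ g : H ≃ₐ[ℚ] H, ∃! t, t ∈ T ∧ (t = g ∨ t = g * τ))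
    (hηT : (∏ g ∈ T, galU H g η) = 1)
    (hηker : ∀ a : (H ≃ₐ[ℚ] H) → ℤ,
      (∏ g ∈ T, galU H g η ^ a g) = 1 ↔ ∃ c : ℤ, ∀ g ∈ T, a g = c)
    -- representatives of the left cosets of `{1, τ}` in `G`
    (S : Finset (H ≃ₐ[ℚ] H)) (hSG : ∀ s ∈ S, s ∈ Gsub)
    (hS : ∀ g ∈ Gsub, ∃! s, s ∈ S ∧ (s = g ∨ s = g * τ))
    -- the index `i` and the membership `τᵢ = hᵢ⁻¹ τ hᵢ ∈ G`
    (i : Fin d) (hτi : (h i)⁻¹ * τ * h i ∈ Gsub)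
    -- `V_i ⊗ ℚ̄` is `G`-stable
    (hstab : ∀ g ∈ Gsub, ∀ x ∈ VMod H S η (h i), actA H g x ∈ VMod H S η (h i))
    -- the structural algebra homomorphism `ℚ̄[G] → End_ℚ̄(V_i ⊗ ℚ̄)`
    (Φ : MonoidAlgebra Qbar ↥Gsub →ₐ[Qbar] Module.End Qbar ↥(VMod H S η (h i)))
    (hΦ : ∀ (g : ↥Gsub) (w : ↥(VMod H S η (h i))),
      (↑(Φ (MonoidAlgebra.single g 1) w) : UnitsMod H) = actA H ↑g ↑w)
    -- an irreducible `ℚ̄`-linear representation `π = (V, ρ)` of `G`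
    (V : Type*) [AddCommGroup V] [Module Qbar V] [FiniteDimensional Qbar V] [Nontrivial V]
    (ρ : Representation Qbar ↥Gsub V)
    (hirr : ∀ W : Submodule Qbar V, (∀ g : ↥Gsub, ∀ v ∈ W, ρ g v ∈ W) → W = ⊥ ∨ W = ⊤) :
    (((∀ g : ↥Gsub, ρ g = LinearMap.id) ∨
        LinearMap.ker (ρ (⟨(h i)⁻¹ * τ * h i, hτi⟩ : ↥Gsub) - LinearMap.id) = ⊥) →
      Module.finrank Qbar
        ↥(intertwiners Qbar V (MonoidAlgebra Qbar ↥Gsub)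
            (fun g : ↥Gsub => ρ g)
            (fun g : ↥Gsub => LinearMap.mulLeft Qbar (MonoidAlgebra.single g 1))
            (LinearMap.ker Φ.toLinearMap)) = Module.finrank Qbar V) ∧
    ((¬ ((∀ g : ↥Gsub, ρ g = LinearMap.id) ∨
        LinearMap.ker (ρ (⟨(h i)⁻¹ * τ * h i, hτi⟩ : ↥Gsub) - LinearMap.id) = ⊥)) →
      Module.finrank Qbar
        ↥(intertwiners Qbar V (MonoidAlgebra Qbar ↥Gsub)
            (fun g : ↥Gsub => ρ g)
            (fun g : ↥Gsub => LinearMap.mulLeft Qbar (MonoidAlgebra.single g 1))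
            (LinearMap.ker Φ.toLinearMap)) = 0) := by
  obtain ⟨htt, hJ⟩ := kernel_aux H τ hτ2 hτ1 Gsub η hητ T hT hηT hηker S hSG hS (h i) hτi Φ hΦ
  exact rep_main ρ _ htt hirr _ hJ
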